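/- Assume N ≥ 3 and p > 1 + 4/(N−2). For every ε with 0 < ε < 1 there exists M = M(ε) > 0 such that limsup_{c→+∞} H_v(M c^{−(p−1)/2}, c) ≤ −α(N−2−α)·((1−ε)²/2 − (1−ε)^{p+1}/(p+1)). -/

import Mathlib

open Set Filter

noncomputable def alphaP (p : ℝ) : ℝ := 2 / (p - 1)

noncomputable def b0 (p : ℝ) : ℝ := (2 * (p + 1) / (p - 1) ^ 2) ^ ((1 : ℝ) / (p - 1))

noncomputable def bInf (N : ℕ) (p : ℝ) : ℝ :=
  (alphaP p * ((N : ℝ) - 2 - alphaP p)) ^ (alphaP p / 2)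

noncomputable def uInf (N : ℕ) (p : ℝ) (ρ : ℝ) : ℝ := bInf N p * ρ ^ (-(alphaP p))

/-- `u` solves `(1-ρ²)u'' + ((N-1)/ρ - 2(α+1)ρ)u' - α(α+1)u + |u|^{p-1}u = 0` on `s`. -/
def IsSolOn (N : ℕ) (p : ℝ) (u : ℝ → ℝ) (s : Set ℝ) : Prop :=
  ∀ ρ ∈ s,
    (1 - ρ ^ 2) * deriv (deriv u) ρ
      + (((N : ℝ) - 1) / ρ - 2 * (alphaP p + 1) * ρ) * deriv u ρ
      - alphaP p * (alphaP p + 1) * u ρ + |u ρ| ^ (p - 1) * u ρ = 0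

/-- `v(ρ,c) = u(ρ,c)/u_∞(ρ)`. -/
noncomputable def vFun (N : ℕ) (p : ℝ) (u : ℝ → ℝ → ℝ) (c ρ : ℝ) : ℝ :=
  u c ρ / uInf N p ρ

/-- The Lyapunov function `H_v(ρ,c)`. -/
noncomputable def Hv (N : ℕ) (p : ℝ) (u : ℝ → ℝ → ℝ) (ρ c : ℝ) : ℝ :=
  1 / 2 * ρ ^ 2 * (1 - ρ ^ 2) * (deriv (vFun N p u c) ρ) ^ 2
    - alphaP p * ((N : ℝ) - 2 - alphaP p) *
      ((vFun N p u c ρ) ^ 2 / 2 - |vFun N p u c ρ| ^ (p + 1) / (p + 1))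

/-- The potential `x²/2 - |x|^{p+1}/(p+1)`, in terms of which `H_v` is written. -/
noncomputable def potential (p x : ℝ) : ℝ := x ^ 2 / 2 - |x| ^ (p + 1) / (p + 1)

/-- `H_v` in the logarithmic variable `t = log ρ`, as a function of `v` and `∂_t v`. -/
noncomputable def logEnergy (β p t y q : ℝ) : ℝ :=
  1 / 2 * (1 - Real.exp t ^ 2) * q ^ 2 - β * potential p y

/-- The equation satisfied by `v` in the logarithmic variable `t = log ρ`, with `q = ∂_t v` and
`a = ∂_t q`. -/
def LogODE (β γ p t y q a : ℝ) : Prop :=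
  (1 - Real.exp t ^ 2) * a + (γ - Real.exp t ^ 2) * q + β * (|y| ^ (p - 1) * y - y) = 0

theorem abs_rpow_add_one {p : ℝ} (hp : 1 < p) (x : ℝ) :
    |x| ^ (p + 1) = |x| ^ (p - 1) * x ^ 2 := by
  rw [show p + 1 = (p - 1) + (2 : ℕ) by push_cast; ring,
    Real.rpow_add_natCast' (abs_nonneg x) (by push_cast; linarith), sq_abs]

theorem continuous_potential {p : ℝ} (hp : 1 < p) : Continuous (potential p) := by
  have : Continuous fun x : ℝ => |x| ^ (p + 1) :=
    continuous_abs.rpow_const fun _ => Or.inr (by linarith)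
  unfold potential
  fun_prop

theorem hasDerivAt_potential {p : ℝ} (hp : 1 < p) (x : ℝ) :
    HasDerivAt (potential p) (x - |x| ^ (p - 1) * x) x := by
  have h := (((hasDerivAt_id x).pow 2).div_const 2).sub
    ((hasDerivAt_abs_rpow x (show 1 < p + 1 by linarith)).div_const (p + 1))
  refine h.congr_deriv ?_
  rw [show p + 1 - 2 = p - 1 by ring]
  have hp1 : p + 1 ≠ 0 := by linarith
  field_simp
  simp
  ring

theorem potential_lt_of_sq_ne_one {p : ℝ} (hp : 1 < p) {x : ℝ} (hx : x ^ 2 ≠ 1) :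
    potential p x < 1 / 2 - 1 / (p + 1) := by
  have h := one_add_mul_self_lt_rpow_one_add (s := x ^ 2 - 1) (by nlinarith [sq_nonneg x])
    (sub_ne_zero.2 hx) (show 1 < (p + 1) / 2 by linarith)
  have e : (1 + (x ^ 2 - 1)) ^ ((p + 1) / 2) = |x| ^ (p + 1) := by
    rw [show 1 + (x ^ 2 - 1) = |x| ^ (2 : ℝ) by rw [Real.rpow_two, sq_abs]; ring,
      ← Real.rpow_mul (abs_nonneg x)]
    congr 1; ring
  rw [e] at h
  have hp1 : 0 < p + 1 := by linarith
  have h2 : (1 + (p + 1) / 2 * (x ^ 2 - 1)) / (p + 1) < |x| ^ (p + 1) / (p + 1) := by gcongr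
  have h3 : (1 + (p + 1) / 2 * (x ^ 2 - 1)) / (p + 1) = 1 / (p + 1) + (x ^ 2 - 1) / 2 := by
    field_simp
  unfold potential
  linarith

theorem potential_le {p : ℝ} (hp : 1 < p) (x : ℝ) : potential p x ≤ 1 / 2 - 1 / (p + 1) := by
  by_cases hx : x ^ 2 = 1
  · have : |x| = 1 := by rwa [← sq_eq_sq₀ (abs_nonneg x) zero_le_one, sq_abs, one_pow]
    simp [potential, hx, this]
  · exact (potential_lt_of_sq_ne_one hp hx).le

theorem abs_le_of_potential_pos {p : ℝ} (hp : 1 < p) {x : ℝ} (hx : 0 < potential p x) :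
    |x| ≤ ((p + 1) / 2) ^ (1 / (p - 1)) := by
  have h1 : |x| ^ (p - 1) ≤ (p + 1) / 2 := by
    unfold potential at hx
    rw [abs_rpow_add_one hp] at hx
    by_contra! h
    have : (p + 1) / 2 * x ^ 2 / (p + 1) ≤ |x| ^ (p - 1) * x ^ 2 / (p + 1) := by
      have : 0 < p + 1 := by linarith
      gcongr
    have e : (p + 1) / 2 * x ^ 2 / (p + 1) = x ^ 2 / 2 := by
      field_simp [show p + 1 ≠ 0 by linarith]
    linarith
  have hp1 : 0 < p - 1 := by linarith
  calc |x| = (|x| ^ (p - 1)) ^ (1 / (p - 1)) := by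
        rw [← Real.rpow_mul (abs_nonneg x), mul_one_div_cancel hp1.ne', Real.rpow_one]
    _ ≤ _ := by gcongr

theorem force_mul_cubic_nonneg {p : ℝ} (hp : 1 < p) (x : ℝ) :
    0 ≤ (|x| ^ (p - 1) * x - x) * (x ^ 3 - x) := by
  have e : (|x| ^ (p - 1) * x - x) * (x ^ 3 - x) =
      x ^ 2 * ((|x| ^ (p - 1) - 1) * (|x| ^ 2 - 1)) := by rw [sq_abs]; ring
  rw [e]
  refine mul_nonneg (sq_nonneg x) ?_
  rcases le_total |x| 1 with h | h
  · exact mul_nonneg_of_nonpos_of_nonpos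
      (sub_nonpos.2 (Real.rpow_le_one (abs_nonneg x) h (by linarith)))
      (by nlinarith [abs_nonneg x])
  · exact mul_nonneg (sub_nonneg.2 (Real.one_le_rpow h (by linarith))) (by nlinarith)

theorem force_mul_cubic_ne_zero {p : ℝ} (hp : 1 < p) {x : ℝ} (h0 : x ≠ 0) (h1 : x ^ 2 ≠ 1) :
    (|x| ^ (p - 1) * x - x) * (x ^ 3 - x) ≠ 0 := by
  have ha : |x| ≠ 1 := fun h => h1 (by rw [← sq_abs, h, one_pow])
  have hr : |x| ^ (p - 1) ≠ 1 := by
    rwa [Ne, ← Real.rpow_left_inj (abs_nonneg x) zero_le_one (show p - 1 ≠ 0 by linarith),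
      Real.one_rpow] at ha
  have e : (|x| ^ (p - 1) * x - x) * (x ^ 3 - x) =
      x ^ 2 * ((|x| ^ (p - 1) - 1) * (x ^ 2 - 1)) := by ring
  rw [e]
  exact mul_ne_zero (pow_ne_zero 2 h0) (mul_ne_zero (sub_ne_zero.2 hr) (sub_ne_zero.2 h1))

/-- Where the potential is positive and stays below its maximum, the product of the force with the
multiplier `x³ - x` is bounded below. -/
theorem exists_le_force_mul_cubic {p : ℝ} (hp : 1 < p) {δ m : ℝ} (hδ : 0 < δ)
    (hm : m < 1 / 2 - 1 / (p + 1)) :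
    ∃ η > 0, ∀ x, δ ≤ potential p x → potential p x ≤ m →
      η ≤ (|x| ^ (p - 1) * x - x) * (x ^ 3 - x) := by
  set Y := ((p + 1) / 2) ^ (1 / (p - 1))
  set K := Icc (-Y) Y ∩ potential p ⁻¹' Icc δ m
  have hK : IsCompact K :=
    isCompact_Icc.inter_right (isClosed_Icc.preimage (continuous_potential hp))
  have hcont : Continuous fun x : ℝ => (|x| ^ (p - 1) * x - x) * (x ^ 3 - x) := by
    have : Continuous fun x : ℝ => |x| ^ (p - 1) :=
      continuous_abs.rpow_const fun _ => Or.inr (by linarith)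
    fun_prop
  have hmem : ∀ x, δ ≤ potential p x → potential p x ≤ m → x ∈ K := fun x h1 h2 =>
    ⟨abs_le.1 (abs_le_of_potential_pos hp (hδ.trans_le h1)), h1, h2⟩
  rcases K.eq_empty_or_nonempty with hE | hE
  · exact ⟨1, one_pos, fun x h1 h2 => absurd (hmem x h1 h2) (by simp [hE])⟩
  · obtain ⟨z, hz, hmin⟩ := hK.exists_isMinOn hE hcont.continuousOn
    refine ⟨_, lt_of_le_of_ne (force_mul_cubic_nonneg hp z)
      (force_mul_cubic_ne_zero hp ?_ ?_).symm, fun x h1 h2 => hmin (hmem x h1 h2)⟩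
    · rintro rfl
      have h := hz.2.1
      simp [potential, Real.zero_rpow (show p + 1 ≠ 0 by linarith)] at h
      linarith
    · intro hz1
      have ha : |z| = 1 := by rwa [← sq_eq_sq₀ (abs_nonneg z) zero_le_one, sq_abs, one_pow]
      have h := hz.2.2
      simp only [potential, hz1, ha, Real.one_rpow] at h
      linarith

theorem hasDerivAt_logEnergy {β γ p t : ℝ} {y q : ℝ → ℝ} {a : ℝ} (hp : 1 < p)
    (hy : HasDerivAt y (q t) t) (hq : HasDerivAt q a t) (h : LogODE β γ p t (y t) (q t) a) :
    HasDerivAt (fun t => logEnergy β p t (y t) (q t)) (-γ * q t ^ 2) t := by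
  have he := (Real.hasDerivAt_exp t).pow 2
  have := (((he.const_sub 1).const_mul (1 / 2)).mul (hq.pow 2)).sub
    (((hasDerivAt_potential hp (y t)).comp t hy).const_mul β)
  refine this.congr_deriv ?_
  simp only [Pi.pow_apply]
  unfold LogODE at h
  push_cast
  linear_combination (q t) * h

theorem hasDerivAt_logMultiplier {β γ p t : ℝ} {y q : ℝ → ℝ} {a : ℝ}
    (hy : HasDerivAt y (q t) t) (hq : HasDerivAt q a t) (h : LogODE β γ p t (y t) (q t) a) :
    HasDerivAt (fun t => (1 - Real.exp t ^ 2) * q t * (y t ^ 3 - y t))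
      (-(γ + Real.exp t ^ 2) * q t * (y t ^ 3 - y t)
        - β * ((|y t| ^ (p - 1) * y t - y t) * (y t ^ 3 - y t))
        + (1 - Real.exp t ^ 2) * q t ^ 2 * (3 * y t ^ 2 - 1)) t := by
  have he := (Real.hasDerivAt_exp t).pow 2
  have := ((he.const_sub 1).mul hq).mul ((hy.pow 3).sub hy)
  refine this.congr_deriv ?_
  simp only [Pi.pow_apply, Pi.sub_apply, Pi.mul_apply]
  unfold LogODE at h
  push_cast
  linear_combination (y t ^ 3 - y t) * h

/-- The dissipation `-γ q²` of the energy, corrected by a small multiple `κ` of the derivative of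
the multiplier, is bounded away from zero once `q²` or the force term `f` is. -/
theorem multiplier_decay {β γ κ η G G' e q g g' f : ℝ} (hβ : 0 < β) (hγ : 0 < γ) (hκ : 0 < κ)
    (hκ1 : κ ≤ 1) (hκ2 : κ * G' ≤ γ / 4) (hκ3 : κ * ((γ + 1) ^ 2 * G ^ 2 / γ) ≤ γ * η / 4)
    (hκ4 : κ * ((γ + 1) ^ 2 * G ^ 2 / γ) ≤ β * η / 2) (he : 0 ≤ e) (he1 : e ≤ 1)
    (hg : |g| ≤ G) (hg' : g' ≤ G') (hf : 0 ≤ f) (h : η ≤ q ^ 2 ∨ η ≤ f) :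
    -γ * q ^ 2 + κ * (-(γ + e) * q * g - β * f + (1 - e) * q ^ 2 * g') ≤
      -min (γ * η / 4) (κ * β * η / 2) := by
  set A := (γ + 1) ^ 2 * G ^ 2 / γ with hA
  have hA0 : 0 ≤ A := by positivity
  have hcross : κ * (-(γ + e) * q * g) ≤ γ / 4 * q ^ 2 + κ * (κ * A) := by
    have h1 : (γ + e) ^ 2 * g ^ 2 / γ ≤ A := by
      have hg2 : g ^ 2 ≤ G ^ 2 := by rw [← sq_abs g]; gcongr
      rw [hA]; gcongr
    have h2 : κ ^ 2 * ((γ + e) ^ 2 * g ^ 2 / γ) ≤ κ ^ 2 * A := by gcongr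
    have h3 : 0 ≤ (γ / 2 * q + κ * (γ + e) * g) ^ 2 / γ := by positivity
    have h4 : (γ / 2 * q + κ * (γ + e) * g) ^ 2 / γ =
        γ / 4 * q ^ 2 + κ * (γ + e) * g * q + κ ^ 2 * ((γ + e) ^ 2 * g ^ 2 / γ) := by
      field_simp
      ring
    linarith
  have hquad : κ * ((1 - e) * q ^ 2 * g') ≤ γ / 4 * q ^ 2 := by
    have h1 : 0 ≤ (1 - e) * q ^ 2 := mul_nonneg (by linarith) (sq_nonneg _)
    have h2 : (1 - e) * (γ / 4 * q ^ 2) ≤ 1 * (γ / 4 * q ^ 2) := by gcongr; linarith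
    calc κ * ((1 - e) * q ^ 2 * g') ≤ κ * ((1 - e) * q ^ 2 * G') := by gcongr
      _ = (1 - e) * q ^ 2 * (κ * G') := by ring
      _ ≤ (1 - e) * q ^ 2 * (γ / 4) := by gcongr
      _ ≤ _ := by linarith
  have hμ1 : min (γ * η / 4) (κ * β * η / 2) ≤ γ * η / 4 := min_le_left _ _
  have hμ2 : min (γ * η / 4) (κ * β * η / 2) ≤ κ * β * η / 2 := min_le_right _ _
  rcases h with h | h
  · have h1 : γ * η ≤ γ * q ^ 2 := by gcongr
    have h2 : κ * (κ * A) ≤ 1 * (κ * A) := by gcongr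
    have h3 : 0 ≤ κ * β * f := by positivity
    linarith
  · have h1 : κ * β * η ≤ κ * β * f := by gcongr
    have h2 : κ * (κ * A) ≤ κ * (β * η / 2) := by gcongr
    have h3 : 0 ≤ γ * q ^ 2 := by positivity
    linarith

/-- Along solutions of the logarithmic equation, a negative energy level is brought below any level
`-β θ` above the minimum of the energy within a uniform time. -/
theorem exists_uniform_time {β γ p δ θ : ℝ} (hβ : 0 < β) (hγ : 0 < γ) (hp : 1 < p) (hδ : 0 < δ)
    (hθ : θ < 1 / 2 - 1 / (p + 1)) :
    ∃ L > 0, ∀ (y q a : ℝ → ℝ) (t₀ : ℝ), Real.exp (t₀ + L) ≤ 1 / 2 →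
      (∀ t ∈ Icc t₀ (t₀ + L), HasDerivAt y (q t) t ∧ HasDerivAt q (a t) t ∧
        LogODE β γ p t (y t) (q t) (a t)) →
      logEnergy β p t₀ (y t₀) (q t₀) ≤ -δ →
      logEnergy β p (t₀ + L) (y (t₀ + L)) (q (t₀ + L)) ≤ -(β * θ) := by
  obtain ⟨m, hθm, hm⟩ := exists_between hθ
  obtain ⟨η₁, hη₁, hforce⟩ := exists_le_force_mul_cubic hp (δ := δ / β) (by positivity) hm
  set Y : ℝ := ((p + 1) / 2) ^ (1 / (p - 1)) with hY
  have hY0 : 0 ≤ Y := Real.rpow_nonneg (by linarith) _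
  set G : ℝ := Y ^ 3 + Y with hG
  set G' : ℝ := 3 * Y ^ 2 + 1 with hG'
  have hG0 : 0 ≤ G := by positivity
  have hG'0 : 0 < G' := by positivity
  set B : ℝ := 2 * β + 1 with hB
  set η : ℝ := min η₁ (2 * β * (m - θ)) with hη
  have hη0 : 0 < η := lt_min hη₁ (by have := sub_pos.2 hθm; positivity)
  set A : ℝ := (γ + 1) ^ 2 * G ^ 2 / γ with hA
  have hA0 : 0 ≤ A := by positivity
  obtain ⟨κ, hκ0, hκ1, hκ2, hκ3, hκ4⟩ : ∃ κ > 0, κ ≤ 1 ∧ κ * G' ≤ γ / 4 ∧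
      κ * A ≤ γ * η / 4 ∧ κ * A ≤ β * η / 2 := by
    refine ⟨min 1 (min (γ / 4 / G') (min (γ * η / 4 / (A + 1)) (β * η / 2 / (A + 1)))),
      by positivity, min_le_left _ _, ?_, ?_, ?_⟩
    · rw [← le_div_iff₀ hG'0]
      exact (min_le_right _ _).trans (min_le_left _ _)
    · refine le_trans (mul_le_mul_of_nonneg_left (by linarith : A ≤ A + 1) (by positivity)) ?_
      rw [← le_div_iff₀ (by positivity)]
      exact (min_le_right _ _).trans ((min_le_right _ _).trans (min_le_left _ _))
    · refine le_trans (mul_le_mul_of_nonneg_left (by linarith : A ≤ A + 1) (by positivity)) ?_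
      rw [← le_div_iff₀ (by positivity)]
      exact (min_le_right _ _).trans ((min_le_right _ _).trans (min_le_right _ _))
  set μ : ℝ := min (γ * η / 4) (κ * β * η / 2) with hμ
  have hμ0 : 0 < μ := by positivity
  refine ⟨(β * |θ| + 2 * B * G) / μ + 1, by positivity, ?_⟩
  set L := (β * |θ| + 2 * B * G) / μ + 1 with hL
  have hL0 : 0 < L := by positivity
  intro y q a t₀ hexp hsol h0
  by_contra! hT
  set H : ℝ → ℝ := fun t => logEnergy β p t (y t) (q t) with hH
  have hHd : ∀ t ∈ Icc t₀ (t₀ + L), HasDerivAt H (-γ * q t ^ 2) t := fun t ht =>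
    hasDerivAt_logEnergy hp (hsol t ht).1 (hsol t ht).2.1 (hsol t ht).2.2
  have hanti : AntitoneOn H (Icc t₀ (t₀ + L)) := by
    refine antitoneOn_of_hasDerivWithinAt_nonpos (convex_Icc _ _)
      (fun t ht => (hHd t ht).continuousAt.continuousWithinAt)
      (fun t ht => (hHd t (interior_subset ht)).hasDerivWithinAt) fun t _ => ?_
    nlinarith [sq_nonneg (q t)]
  have hl : t₀ ∈ Icc t₀ (t₀ + L) := left_mem_Icc.2 (by linarith)
  have hr : t₀ + L ∈ Icc t₀ (t₀ + L) := right_mem_Icc.2 (by linarith)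
  have hexp2 : ∀ t ∈ Icc t₀ (t₀ + L), 0 ≤ Real.exp t ^ 2 ∧ Real.exp t ^ 2 ≤ 1 / 4 := by
    intro t ht
    have h1 : Real.exp t ≤ 1 / 2 := (Real.exp_le_exp.2 ht.2).trans hexp
    exact ⟨by positivity, by nlinarith [Real.exp_pos t]⟩
  have hpot : ∀ t ∈ Icc t₀ (t₀ + L), δ / β ≤ potential p (y t) := by
    intro t ht
    have h1 : H t ≤ -δ := (hanti hl ht ht.1).trans h0
    have h2 : -(β * potential p (y t)) ≤ H t := by
      have : 0 ≤ 1 / 2 * (1 - Real.exp t ^ 2) * q t ^ 2 := by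
        have := (hexp2 t ht).2
        exact mul_nonneg (by linarith) (sq_nonneg _)
      simp only [hH, logEnergy]
      linarith
    rw [div_le_iff₀ hβ]
    linarith
  have hy : ∀ t ∈ Icc t₀ (t₀ + L), |y t| ≤ Y := fun t ht =>
    abs_le_of_potential_pos hp (lt_of_lt_of_le (by positivity) (hpot t ht))
  have hq : ∀ t ∈ Icc t₀ (t₀ + L), |q t| ≤ B := by
    intro t ht
    have h1 : H t ≤ -δ := (hanti hl ht ht.1).trans h0
    have h2 : potential p (y t) ≤ 1 / 2 := by
      have := potential_le hp (y t)
      have : 0 < 1 / (p + 1) := by have : 0 < p + 1 := by linarith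
                                   positivity
      linarith
    have h3 : β * potential p (y t) ≤ β * (1 / 2) := by gcongr
    have h4 : q t ^ 2 ≤ 2 * β := by
      simp only [hH, logEnergy] at h1
      nlinarith [sq_nonneg (q t), (hexp2 t ht).2]
    refine abs_le_of_sq_le_sq ?_ (by positivity)
    rw [hB]
    nlinarith
  have hg : ∀ t ∈ Icc t₀ (t₀ + L), |y t ^ 3 - y t| ≤ G := by
    intro t ht
    calc |y t ^ 3 - y t| ≤ |y t ^ 3| + |y t| := abs_sub _ _
      _ = |y t| ^ 3 + |y t| := by rw [abs_pow]
      _ ≤ Y ^ 3 + Y := by have := hy t ht; gcongr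
  have hg' : ∀ t ∈ Icc t₀ (t₀ + L), 3 * y t ^ 2 - 1 ≤ G' := by
    intro t ht
    have : y t ^ 2 ≤ Y ^ 2 := by rw [← sq_abs]; have := hy t ht; gcongr
    linarith
  have hdich : ∀ t ∈ Icc t₀ (t₀ + L),
      η ≤ q t ^ 2 ∨ η ≤ (|y t| ^ (p - 1) * y t - y t) * (y t ^ 3 - y t) := by
    intro t ht
    rcases le_or_gt (potential p (y t)) m with h | h
    · exact Or.inr ((min_le_left _ _).trans (hforce _ (hpot t ht) h))
    · left
      refine (min_le_right _ _).trans ?_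
      have h1 : -(β * θ) < H t := hT.trans_le (hanti ht hr ht.2)
      have h2 : β * m < β * potential p (y t) := by gcongr
      have h3 : 0 ≤ Real.exp t ^ 2 * q t ^ 2 := by positivity
      simp only [hH, logEnergy] at h1
      linarith
  set Q : ℝ → ℝ := fun t => (1 - Real.exp t ^ 2) * q t * (y t ^ 3 - y t) with hQ
  have hQb : ∀ t ∈ Icc t₀ (t₀ + L), |Q t| ≤ B * G := by
    intro t ht
    have h1 : |1 - Real.exp t ^ 2| ≤ 1 := by
      rw [abs_le]
      constructor <;> linarith [(hexp2 t ht).1, (hexp2 t ht).2]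
    calc |Q t| = |1 - Real.exp t ^ 2| * |q t| * |y t ^ 3 - y t| := by
          simp only [hQ, abs_mul]
      _ ≤ 1 * B * G := by
          have := hq t ht
          have := hg t ht
          gcongr
      _ = B * G := by ring
  have hdecay : H (t₀ + L) + κ * Q (t₀ + L) - (H t₀ + κ * Q t₀) ≤ -μ * (t₀ + L - t₀) := by
    have hd : ∀ t ∈ Icc t₀ (t₀ + L), HasDerivAt (fun t => H t + κ * Q t) _ t := fun t ht =>
      (hHd t ht).add ((hasDerivAt_logMultiplier (hsol t ht).1 (hsol t ht).2.1
        (hsol t ht).2.2).const_mul κ)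
    refine Convex.image_sub_le_mul_sub_of_deriv_le (f := fun t => H t + κ * Q t) (convex_Icc _ _)
      (fun t ht => (hd t ht).continuousAt.continuousWithinAt)
      (fun t ht => (hd t (interior_subset ht)).differentiableAt.differentiableWithinAt)
      (fun t ht => ?_) t₀ hl (t₀ + L) hr (by linarith)
    replace ht := interior_subset ht
    rw [(hd t ht).deriv]
    exact multiplier_decay hβ hγ hκ0 hκ1 hκ2 hκ3 hκ4 (hexp2 t ht).1
      (by linarith [(hexp2 t ht).2]) (hg t ht) (hg' t ht) (force_mul_cubic_nonneg hp _)
      (hdich t ht)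
  have hκQ : ∀ t ∈ Icc t₀ (t₀ + L), |κ * Q t| ≤ B * G := fun t ht => by
    rw [abs_mul, abs_of_pos hκ0]
    exact (mul_le_of_le_one_left (abs_nonneg _) hκ1).trans (hQb t ht)
  have hκQ0 := (abs_le.1 (hκQ _ hl)).2
  have hκQ1 := (abs_le.1 (hκQ _ hr)).1
  have hH0 : H t₀ ≤ -δ := h0
  have hH1 : -(β * θ) < H (t₀ + L) := hT
  have hμL : μ * L = β * |θ| + 2 * B * G + μ := by
    rw [hL]
    field_simp
  have : β * θ ≤ β * |θ| := by have := le_abs_self θ; gcongr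
  linarith

theorem alphaP_pos {p : ℝ} (hp : 1 < p) : 0 < alphaP p :=
  div_pos two_pos (sub_pos.2 hp)

theorem alphaP_mul {p : ℝ} (hp : 1 < p) : alphaP p * (p - 1) = 2 :=
  div_mul_cancel₀ _ (sub_pos.2 hp).ne'

theorem exists_energy_remainder_le {p κ : ℝ} (hp : 1 < p) (hκ : 0 ≤ κ) :
    ∃ K, ∀ x : ℝ, κ * x ^ 2 / 2 - |x| ^ (p + 1) / (p + 1) ≤ K := by
  set R := (κ * (p + 1) / 2) ^ (1 / (p - 1))
  have hp1 : 0 < p + 1 := by linarith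
  have hp2 : 0 < p - 1 := by linarith
  refine ⟨κ * R ^ 2 / 2, fun x => ?_⟩
  rw [abs_rpow_add_one hp]
  have hx : 0 ≤ |x| ^ (p - 1) := by positivity
  rcases le_total |x| R with h | h
  · have h1 : x ^ 2 ≤ R ^ 2 := by rw [← sq_abs]; gcongr
    have h2 : κ * x ^ 2 ≤ κ * R ^ 2 := by gcongr
    have h3 : 0 ≤ |x| ^ (p - 1) * x ^ 2 / (p + 1) := by positivity
    linarith
  · have hR : 0 ≤ R := by positivity
    have h1 : R ^ (p - 1) ≤ |x| ^ (p - 1) := by gcongr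
    have h2 : R ^ (p - 1) = κ * (p + 1) / 2 := by
      rw [← Real.rpow_mul (by positivity), one_div_mul_cancel hp2.ne', Real.rpow_one]
    have h3 : (κ * (p + 1) / 2) * x ^ 2 / (p + 1) ≤ |x| ^ (p - 1) * x ^ 2 / (p + 1) := by
      rw [← h2]; gcongr
    have h4 : (κ * (p + 1) / 2) * x ^ 2 / (p + 1) = κ * x ^ 2 / 2 := by field_simp
    have h5 : 0 ≤ κ * R ^ 2 / 2 := by positivity
    linarith

section Solution

variable {N : ℕ} {p c : ℝ} {w : ℝ → ℝ}

theorem hasDerivAt_of_contDiffOn_Ico (hw : ContDiffOn ℝ 2 w (Ico 0 1)) {ρ : ℝ}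
    (hρ : ρ ∈ Ioo (0 : ℝ) 1) :
    HasDerivAt w (deriv w ρ) ρ ∧ HasDerivAt (deriv w) (deriv (deriv w) ρ) ρ := by
  have h : ContDiffOn ℝ 2 w (Ioo 0 1) := hw.mono Ioo_subset_Ico_self
  have h1 : ContDiffOn ℝ 1 (deriv w) (Ioo 0 1) :=
    ((contDiffOn_succ_iff_deriv_of_isOpen (n := 1) isOpen_Ioo).1 h).2.2
  have hn := isOpen_Ioo.mem_nhds hρ
  exact ⟨((h.differentiableOn (by norm_num)).differentiableAt hn).hasDerivAt,
    ((h1.differentiableOn (by norm_num)).differentiableAt hn).hasDerivAt⟩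

/-- The energy of a regular solution controls its first derivative, uniformly in the amplitude. -/
theorem abs_deriv_le_of_isSolOn (hp : 1 < p) (hN : 2 * alphaP p + 1 ≤ (N : ℝ) - 1)
    (hw : ContDiffOn ℝ 2 w (Ico 0 1)) (hsol : IsSolOn N p w (Ioo 0 1)) (hw0 : w 0 = c)
    (hw1 : derivWithin w (Ici 0) 0 = 0) (hc : 0 < c) {K : ℝ}
    (hK : ∀ x : ℝ, alphaP p * (alphaP p + 1) * x ^ 2 / 2 - |x| ^ (p + 1) / (p + 1) ≤ K)
    (hKc : K ≤ c ^ (p + 1) / 2) {ρ : ℝ} (hρ : ρ ∈ Icc (0 : ℝ) (1 / 2)) :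
    |derivWithin w (Ico 0 1) ρ| ≤ 2 * c ^ ((p + 1) / 2) := by
  have hα := alphaP_pos hp
  set α := alphaP p with hαdef
  set d := derivWithin w (Ico 0 1) with hd
  have hdcont : ContinuousOn d (Ico 0 1) :=
    hw.continuousOn_derivWithin (uniqueDiffOn_Ico 0 1) (by norm_num)
  have hd0 : d 0 = 0 := by
    refine (derivWithin_congr_set ?_).trans hw1
    filter_upwards [Iio_mem_nhds (show (0 : ℝ) < 1 by norm_num)] with x hx
    exact propext ⟨fun h => h.1, fun h => ⟨h, hx⟩⟩
  have hdd : ∀ x ∈ Ioo (0 : ℝ) 1, d x = deriv w x := fun x hx =>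
    derivWithin_of_mem_nhds (Ico_mem_nhds hx.1 hx.2)
  have hderiv : ∀ x ∈ Ioo (0 : ℝ) 1, HasDerivAt d (deriv (deriv w) x) x := fun x hx =>
    (hasDerivAt_of_contDiffOn_Ico hw hx).2.congr_of_eventuallyEq
      (eventually_of_mem (isOpen_Ioo.mem_nhds hx) hdd)
  set P : ℝ → ℝ := fun x => |x| ^ (p + 1) / (p + 1) - α * (α + 1) * x ^ 2 / 2 with hP
  have hPd : ∀ x, HasDerivAt P (|x| ^ (p - 1) * x - α * (α + 1) * x) x := by
    intro x
    have h := ((hasDerivAt_abs_rpow x (show 1 < p + 1 by linarith)).div_const (p + 1)).sub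
      ((((hasDerivAt_id x).pow 2).const_mul (α * (α + 1))).div_const 2)
    refine h.congr_deriv ?_
    rw [show p + 1 - 2 = p - 1 by ring]
    have hp1 : p + 1 ≠ 0 := by linarith
    field_simp
    simp
    ring
  have hPc : Continuous P := continuous_iff_continuousAt.2 fun x => (hPd x).continuousAt
  set E : ℝ → ℝ := fun x => 1 / 2 * (1 - x ^ 2) * d x ^ 2 + P (w x) with hE
  have hsub : Icc (0 : ℝ) (1 / 2) ⊆ Ico 0 1 := fun x hx => ⟨hx.1, by linarith [hx.2]⟩
  have hEd : ∀ x ∈ Ioo (0 : ℝ) 1,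
      HasDerivAt E (-(((N : ℝ) - 1) / x - (2 * α + 1) * x) * d x ^ 2) x := by
    intro x hx
    have h1 := (hasDerivAt_of_contDiffOn_Ico hw hx).1
    have h2 := ((((hasDerivAt_pow 2 x).const_sub 1).const_mul (1 / 2)).mul
      ((hderiv x hx).pow 2)).add ((hPd (w x)).comp x h1)
    refine h2.congr_deriv ?_
    have h3 := hsol x hx
    rw [← hdd x hx] at h3 ⊢
    simp only [Pi.pow_apply]
    push_cast
    linear_combination (d x) * h3
  have hanti : AntitoneOn E (Icc 0 (1 / 2)) := by
    have hint : ∀ x ∈ interior (Icc (0 : ℝ) (1 / 2)), x ∈ Ioo (0 : ℝ) 1 := fun x hx => by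
      rw [interior_Icc] at hx
      exact ⟨hx.1, by linarith [hx.2]⟩
    refine antitoneOn_of_hasDerivWithinAt_nonpos (convex_Icc _ _) ?_
      (fun x hx => (hEd x (hint x hx)).hasDerivWithinAt) fun x hx => ?_
    · have h1 := hdcont.mono hsub
      have h2 := hPc.comp_continuousOn (hw.continuousOn.mono hsub)
      exact (by fun_prop : ContinuousOn (fun x => 1 / 2 * (1 - x ^ 2) * d x ^ 2) _).add h2
    · have hx' := hint x hx
      have h1 : (2 * α + 1) * x ≤ ((N : ℝ) - 1) / x := by
        rw [le_div_iff₀ hx'.1]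
        have : x * x ≤ 1 := by nlinarith [hx'.1, hx'.2]
        nlinarith
      exact mul_nonpos_of_nonpos_of_nonneg (by linarith) (sq_nonneg _)
  have hEρ : E ρ ≤ E 0 := hanti (left_mem_Icc.2 (by norm_num)) hρ hρ.1
  have hE0 : E 0 ≤ c ^ (p + 1) / 2 := by
    have h1 : c ^ (p + 1) / (p + 1) ≤ c ^ (p + 1) / 2 := by gcongr; linarith
    have h2 : 0 ≤ α * (α + 1) * c ^ 2 / 2 := by positivity
    simp only [hE, hP, hd0, hw0, abs_of_pos hc]
    nlinarith
  have hlow : 1 / 2 * (1 - ρ ^ 2) * d ρ ^ 2 ≤ E ρ + K := by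
    have := hK (w ρ)
    simp only [hE, hP]
    linarith
  have hsq : (c ^ ((p + 1) / 2)) ^ 2 = c ^ (p + 1) := by
    rw [← Real.rpow_natCast, ← Real.rpow_mul hc.le]
    congr 1
    push_cast
    ring
  refine abs_le_of_sq_le_sq ?_ (by positivity)
  rw [mul_pow, hsq]
  have hρ2 : ρ ^ 2 ≤ 1 / 4 := by nlinarith [hρ.1, hρ.2]
  nlinarith [sq_nonneg (d ρ)]

theorem abs_sub_le_of_isSolOn (hp : 1 < p) (hN : 2 * alphaP p + 1 ≤ (N : ℝ) - 1)
    (hw : ContDiffOn ℝ 2 w (Ico 0 1)) (hsol : IsSolOn N p w (Ioo 0 1)) (hw0 : w 0 = c)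
    (hw1 : derivWithin w (Ici 0) 0 = 0) (hc : 0 < c) {K : ℝ}
    (hK : ∀ x : ℝ, alphaP p * (alphaP p + 1) * x ^ 2 / 2 - |x| ^ (p + 1) / (p + 1) ≤ K)
    (hKc : K ≤ c ^ (p + 1) / 2) {ρ : ℝ} (hρ : ρ ∈ Icc (0 : ℝ) (1 / 2)) :
    |w ρ - c| ≤ 2 * c ^ ((p + 1) / 2) * ρ := by
  have hsub : Icc (0 : ℝ) (1 / 2) ⊆ Ico 0 1 := fun x hx => ⟨hx.1, by linarith [hx.2]⟩
  have h := Convex.norm_image_sub_le_of_norm_hasDerivWithin_le (s := Icc (0 : ℝ) (1 / 2))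
    (fun x hx => ((hw.differentiableOn (by norm_num) x (hsub hx)).hasDerivWithinAt).mono hsub)
    (fun x hx => abs_deriv_le_of_isSolOn hp hN hw hsol hw0 hw1 hc hK hKc hx)
    (convex_Icc _ _) (left_mem_Icc.2 (by norm_num)) hρ
  rwa [hw0, sub_zero, Real.norm_eq_abs, Real.norm_eq_abs, abs_of_nonneg hρ.1] at h

/-- The function `v` in the logarithmic variable `t = log ρ`. -/
noncomputable def logV (b α : ℝ) (w : ℝ → ℝ) (t : ℝ) : ℝ :=
  Real.exp (α * t) * w (Real.exp t) / b

/-- The first derivative of `logV`. -/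
noncomputable def logVDeriv (b α : ℝ) (w : ℝ → ℝ) (t : ℝ) : ℝ :=
  Real.exp (α * t) * (α * w (Real.exp t) + Real.exp t * deriv w (Real.exp t)) / b

/-- The second derivative of `logV`. -/
noncomputable def logVDeriv2 (b α : ℝ) (w : ℝ → ℝ) (t : ℝ) : ℝ :=
  Real.exp (α * t) * (α ^ 2 * w (Real.exp t) + (2 * α + 1) * Real.exp t * deriv w (Real.exp t)
    + Real.exp t ^ 2 * deriv (deriv w) (Real.exp t)) / b

theorem hasDerivAt_logV (b α : ℝ) (hw : ContDiffOn ℝ 2 w (Ico 0 1)) {t : ℝ}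
    (ht : Real.exp t < 1) :
    HasDerivAt (logV b α w) (logVDeriv b α w t) t ∧
      HasDerivAt (logVDeriv b α w) (logVDeriv2 b α w t) t := by
  obtain ⟨h1, h2⟩ := hasDerivAt_of_contDiffOn_Ico hw ⟨Real.exp_pos t, ht⟩
  have he := Real.hasDerivAt_exp t
  have hα := ((hasDerivAt_id t).const_mul α).exp
  have hw1 := h1.comp t he
  have hw2 := h2.comp t he
  constructor
  · refine ((hα.mul hw1).div_const b).congr_deriv ?_
    simp only [logVDeriv, Function.comp, id]
    ring
  · refine ((hα.mul ((hw1.const_mul α).add (he.mul hw2))).div_const b).congr_deriv ?_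
    simp only [logVDeriv2, Function.comp, id, Pi.add_apply, Pi.mul_apply]
    ring

theorem bInf_rpow (hp : 1 < p) (hβ : 0 < alphaP p * ((N : ℝ) - 2 - alphaP p)) :
    bInf N p ^ (p - 1) = alphaP p * ((N : ℝ) - 2 - alphaP p) := by
  rw [bInf, ← Real.rpow_mul hβ.le,
    show alphaP p / 2 * (p - 1) = 1 by have := alphaP_mul hp; linarith, Real.rpow_one]

theorem logODE_of_isSolOn (hp : 1 < p) (hβ : 0 < alphaP p * ((N : ℝ) - 2 - alphaP p))
    (hsol : IsSolOn N p w (Ioo 0 1)) {t : ℝ} (ht : Real.exp t < 1) :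
    LogODE (alphaP p * ((N : ℝ) - 2 - alphaP p)) ((N : ℝ) - 2 - 2 * alphaP p) p t
      (logV (bInf N p) (alphaP p) w t) (logVDeriv (bInf N p) (alphaP p) w t)
      (logVDeriv2 (bInf N p) (alphaP p) w t) := by
  have hb : 0 < bInf N p := Real.rpow_pos_of_pos hβ _
  have hbp := bInf_rpow hp hβ
  have h := hsol _ ⟨Real.exp_pos t, ht⟩
  have hα := alphaP_mul hp
  have hr := Real.exp_pos t
  have hpow : |logV (bInf N p) (alphaP p) w t| ^ (p - 1) =
      Real.exp t ^ 2 * |w (Real.exp t)| ^ (p - 1) /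
        (alphaP p * ((N : ℝ) - 2 - alphaP p)) := by
    rw [logV, abs_div, abs_mul, abs_of_pos (Real.exp_pos _), abs_of_pos hb,
      Real.div_rpow (by positivity) hb.le, Real.mul_rpow (by positivity) (by positivity), hbp,
      ← Real.exp_mul, show alphaP p * t * (p - 1) = t + t by linear_combination t * hα,
      Real.exp_add, sq]
  rw [LogODE, hpow]
  unfold logV logVDeriv logVDeriv2
  generalize bInf N p = b at *
  set β := alphaP p * ((N : ℝ) - 2 - alphaP p) with hβd
  generalize |w (Real.exp t)| ^ (p - 1) = P at *
  generalize deriv (deriv w) (Real.exp t) = w2 at *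
  generalize deriv w (Real.exp t) = w1 at *
  generalize w (Real.exp t) = w0 at *
  generalize Real.exp (alphaP p * t) = e at *
  generalize Real.exp t = r at *
  have h' : (1 - r ^ 2) * (r ^ 2 * w2) + (((N : ℝ) - 1) - 2 * (alphaP p + 1) * r ^ 2) * (r * w1)
      - alphaP p * (alphaP p + 1) * r ^ 2 * w0 + r ^ 2 * (P * w0) = 0 := by
    have : ((N : ℝ) - 1) / r * r = (N : ℝ) - 1 := div_mul_cancel₀ _ hr.ne'
    linear_combination r ^ 2 * h - r * w1 * this
  have h'' : β * (r ^ 2 * P / β * (e * w0 / b) - e * w0 / b) =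
      e / b * (r ^ 2 * P * w0 - β * w0) := by
    field_simp
  rw [h'', hβd]
  linear_combination e / b * h'

theorem Hv_eq_logEnergy {u : ℝ → ℝ → ℝ} (hu : ContDiffOn ℝ 2 (u c) (Ico 0 1)) {t : ℝ}
    (ht : Real.exp t < 1) :
    Hv N p u (Real.exp t) c = logEnergy (alphaP p * ((N : ℝ) - 2 - alphaP p)) p t
      (logV (bInf N p) (alphaP p) (u c) t) (logVDeriv (bInf N p) (alphaP p) (u c) t) := by
  have hr := Real.exp_pos t
  have hpow : Real.exp t ^ alphaP p = Real.exp (alphaP p * t) := by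
    rw [← Real.exp_mul, mul_comm]
  have heq : ∀ ρ > 0, vFun N p u c ρ = ρ ^ alphaP p * u c ρ / bInf N p := by
    intro ρ hρ
    have : ρ ^ alphaP p ≠ 0 := (Real.rpow_pos_of_pos hρ _).ne'
    rw [vFun, uInf, Real.rpow_neg hρ.le, div_mul_eq_div_div, div_right_comm, div_inv_eq_mul]
    ring
  have hv : vFun N p u c (Real.exp t) = logV (bInf N p) (alphaP p) (u c) t := by
    rw [heq _ hr, hpow, logV]
  have hd : HasDerivAt (vFun N p u c)
      (logVDeriv (bInf N p) (alphaP p) (u c) t / Real.exp t) (Real.exp t) := by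
    have h1 := (hasDerivAt_of_contDiffOn_Ico hu ⟨hr, ht⟩).1
    have h2 := ((Real.hasDerivAt_rpow_const (p := alphaP p) (Or.inl hr.ne')).mul h1).div_const
      (bInf N p)
    refine (h2.congr_of_eventuallyEq ?_).congr_deriv ?_
    · filter_upwards [Ioi_mem_nhds hr] with ρ hρ using heq ρ hρ
    · rw [Real.rpow_sub_one hr.ne', hpow, logVDeriv]
      field_simp
  rw [Hv, hd.deriv, hv, logEnergy, potential]
  field_simp

end Solution

theorem exists_small_radius {α γ P : ℝ} (hα : 0 < α) (hγ : 0 < γ) (hP : 0 ≤ P) :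
    ∃ s > 0, s ≤ 1 / 4 ∧ ∀ U D : ℝ, |U - 1| ≤ 2 * s → |D| ≤ 2 * s →
      1 / 2 * (α * U + D) ^ 2 - α * (α + γ) * U ^ 2 / 2 + s ^ 2 * P ≤ -(α * γ / 16) := by
  set C := 3 * α + 2 + P
  have hC : 0 < C := by positivity
  set s := min (1 / 4) (α * γ / 16 / C)
  have hs0 : 0 < s := by positivity
  have hs1 : s ≤ 1 / 4 := min_le_left _ _
  have hs2 : s * C ≤ α * γ / 16 := by
    rw [← le_div_iff₀ hC]
    exact min_le_right _ _
  refine ⟨s, hs0, hs1, fun U D hU hD => ?_⟩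
  have hU' := abs_le.1 hU
  have hU1 : 1 / 4 ≤ U ^ 2 := by nlinarith
  have hUD : U * D ≤ 3 / 2 * (2 * s) := by
    calc U * D ≤ |U * D| := le_abs_self _
      _ = |U| * |D| := abs_mul _ _
      _ ≤ 3 / 2 * (2 * s) := by
        gcongr
        rw [abs_le]
        constructor <;> linarith
  have hD2 : D ^ 2 ≤ (2 * s) ^ 2 := by rw [← sq_abs]; gcongr
  have h1 : α * (U * D) ≤ α * (3 / 2 * (2 * s)) := by gcongr
  have h2 : α * γ * (1 / 4) ≤ α * γ * U ^ 2 := by gcongr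
  have h3 : s ^ 2 ≤ s := by nlinarith
  have h4 : s ^ 2 * P ≤ s * P := by gcongr
  nlinarith

/-- At distance `s c^{-(p-1)/2}` from the origin, with `s` small and fixed, the energy of the regular
solution of large amplitude `c` is negative, uniformly in `c`. -/
theorem exists_initial_energy_le {N : ℕ} {p : ℝ} (hp : 1 < p) (hN : 2 * alphaP p < (N : ℝ) - 2) :
    ∃ s > 0, ∃ δ > 0, ∀ᶠ c : ℝ in atTop, ∀ w : ℝ → ℝ, ∀ t : ℝ,
      ContDiffOn ℝ 2 w (Ico 0 1) → IsSolOn N p w (Ioo 0 1) → w 0 = c →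
      derivWithin w (Ici 0) 0 = 0 → Real.exp t = s * c ^ (-((p - 1) / 2)) →
      Real.exp t ≤ 1 / 2 →
      logEnergy (alphaP p * ((N : ℝ) - 2 - alphaP p)) p t
        (logV (bInf N p) (alphaP p) w t) (logVDeriv (bInf N p) (alphaP p) w t) ≤ -δ := by
  have hα := alphaP_pos hp
  have hαp := alphaP_mul hp
  have hp1 : 0 < p + 1 := by linarith
  have hβ : 0 < alphaP p * ((N : ℝ) - 2 - alphaP p) := mul_pos hα (by linarith)
  have hbp := bInf_rpow hp hβ
  have hb : 0 < bInf N p := Real.rpow_pos_of_pos hβ _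
  obtain ⟨K, hK⟩ := exists_energy_remainder_le (κ := alphaP p * (alphaP p + 1)) hp (by positivity)
  obtain ⟨s, hs0, hs1, hs⟩ := exists_small_radius (P := 2 ^ (p + 1)) hα
    (show 0 < (N : ℝ) - 2 - 2 * alphaP p by linarith) (by positivity)
  set α := alphaP p with hαdef
  set b := bInf N p
  set z := s ^ α / b with hz
  have hz0 : 0 < z := by positivity
  have hγ : 0 < (N : ℝ) - 2 - 2 * α := by linarith
  refine ⟨s, hs0, z ^ 2 * (α * ((N : ℝ) - 2 - 2 * α) / 16), by positivity, ?_⟩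
  filter_upwards [eventually_gt_atTop 0, (tendsto_rpow_atTop hp1).eventually_ge_atTop (2 * K)]
    with c hc hcK w t hw hsol hw0 hw1 ht ht2
  have hr := Real.exp_pos t
  have hscale : c ^ ((p + 1) / 2) * Real.exp t = s * c := by
    rw [ht, mul_left_comm, ← Real.rpow_add hc]
    ring_nf
    simp
  have hexp : Real.exp (α * t) = s ^ α / c := by
    rw [mul_comm, Real.exp_mul, ht, Real.mul_rpow hs0.le (by positivity), ← Real.rpow_mul hc.le,
      show -((p - 1) / 2) * α = -1 by linarith, Real.rpow_neg_one, div_eq_mul_inv]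
  have hmem : Real.exp t ∈ Icc (0 : ℝ) (1 / 2) := ⟨hr.le, ht2⟩
  have hN' : 2 * alphaP p + 1 ≤ (N : ℝ) - 1 := by linarith
  have hU := abs_sub_le_of_isSolOn hp hN' hw hsol hw0 hw1 hc hK (by linarith) hmem
  have hD := abs_deriv_le_of_isSolOn hp hN' hw hsol hw0 hw1 hc hK (by linarith) hmem
  rw [derivWithin_of_mem_nhds (Ico_mem_nhds hr (by linarith))] at hD
  set U := w (Real.exp t) / c with hUdef
  set D := Real.exp t * deriv w (Real.exp t) / c with hDdef
  have hU1 : |U - 1| ≤ 2 * s := by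
    rw [hUdef, div_sub_one hc.ne', abs_div, abs_of_pos hc, div_le_iff₀ hc]
    linarith
  have hD1 : |D| ≤ 2 * s := by
    rw [hDdef, abs_div, abs_mul, abs_of_pos hc, abs_of_pos hr, div_le_iff₀ hc]
    calc Real.exp t * |deriv w (Real.exp t)| ≤ Real.exp t * (2 * c ^ ((p + 1) / 2)) := by gcongr
      _ = 2 * s * c := by linear_combination 2 * hscale
  have hy : logV b α w t = z * U := by
    rw [logV, hexp, hUdef, hz]
    field_simp
  have hq : logVDeriv b α w t = z * (α * U + D) := by
    rw [logVDeriv, hexp, hUdef, hDdef, hz]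
    field_simp
  have hzp : z ^ (p - 1) = s ^ 2 / (α * ((N : ℝ) - 2 - α)) := by
    rw [hz, Real.div_rpow (by positivity) hb.le, hbp, ← Real.rpow_mul hs0.le, hαp, Real.rpow_two]
  have hUp : |U| ^ (p + 1) ≤ 2 ^ (p + 1) := by
    have : |U| ≤ 2 := by
      have := abs_le.1 hU1
      rw [abs_le]
      constructor <;> linarith
    gcongr
  have hnonlin : α * ((N : ℝ) - 2 - α) * (|z * U| ^ (p + 1) / (p + 1)) ≤
      z ^ 2 * (s ^ 2 * 2 ^ (p + 1)) := by
    have e : α * ((N : ℝ) - 2 - α) * (|z * U| ^ (p + 1) / (p + 1)) =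
        z ^ 2 * (s ^ 2 * |U| ^ (p + 1)) / (p + 1) := by
      rw [abs_mul, Real.mul_rpow (abs_nonneg _) (abs_nonneg _), abs_rpow_add_one hp z,
        abs_of_pos hz0, hzp]
      have : (N : ℝ) - 2 - α ≠ 0 := by linarith
      field_simp
    rw [e]
    refine (div_le_self (by positivity) (by linarith)).trans ?_
    gcongr
  have hkin : 1 / 2 * (1 - Real.exp t ^ 2) * (z * (α * U + D)) ^ 2 ≤
      1 / 2 * (z * (α * U + D)) ^ 2 := by
    nlinarith [mul_nonneg (sq_nonneg (Real.exp t)) (sq_nonneg (z * (α * U + D)))]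
  have hfin : z ^ 2 * _ ≤ z ^ 2 * _ := mul_le_mul_of_nonneg_left (hs U D hU1 hD1) (sq_nonneg z)
  rw [hy, hq, logEnergy, potential]
  linarith

theorem stmt4 (N : ℕ) (p : ℝ) (hN : 3 ≤ N) (hp : 1 + 4 / ((N : ℝ) - 2) < p)
    (u : ℝ → ℝ → ℝ)
    (hu : ∀ c : ℝ,
      ContDiffOn ℝ 2 (u c) (Ico 0 1) ∧
      IsSolOn N p (u c) (Ioo 0 1) ∧
      u c 0 = c ∧
      derivWithin (u c) (Ici 0) 0 = 0)
    (ε : ℝ) (hε : 0 < ε) (hε1 : ε < 1) :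
    ∃ M > 0,
      limsup (fun c : ℝ => Hv N p u (M * c ^ (-((p - 1) / 2))) c) atTop ≤
        -(alphaP p) * ((N : ℝ) - 2 - alphaP p) *
          ((1 - ε) ^ 2 / 2 - (1 - ε) ^ (p + 1) / (p + 1)) := by
  have hN2 : (0 : ℝ) < (N : ℝ) - 2 := by
    have : (3 : ℝ) ≤ N := by exact_mod_cast hN
    linarith
  have hp1 : 1 < p := lt_of_le_of_lt (le_add_of_nonneg_right (by positivity)) hp
  have hα := alphaP_pos hp1
  have hαN : 2 * alphaP p < (N : ℝ) - 2 := by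
    have h1 : 4 / ((N : ℝ) - 2) < p - 1 := by linarith
    have h2 : 4 < (p - 1) * ((N : ℝ) - 2) := (div_lt_iff₀ hN2).1 h1
    rw [alphaP, ← mul_div_assoc, div_lt_iff₀ (by linarith)]
    linarith
  have hβ : 0 < alphaP p * ((N : ℝ) - 2 - alphaP p) := mul_pos hα (by linarith)
  have hsq : (1 - ε) ^ 2 ≠ 1 := by nlinarith
  obtain ⟨s, hs, δ, hδ, hinit⟩ := exists_initial_energy_le hp1 hαN
  obtain ⟨L, hL, hflow⟩ := exists_uniform_time hβ (sub_pos.2 hαN) hp1 hδ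
    (potential_lt_of_sq_ne_one hp1 hsq)
  have hM : 0 < s * Real.exp L := by positivity
  refine ⟨s * Real.exp L, hM, ?_⟩
  have hlim : Tendsto (fun c : ℝ => s * Real.exp L * c ^ (-((p - 1) / 2))) atTop (nhds 0) := by
    simpa using (tendsto_rpow_neg_atTop (show 0 < (p - 1) / 2 by linarith)).const_mul
      (s * Real.exp L)
  have hsmall : ∀ᶠ c : ℝ in atTop, s * Real.exp L * c ^ (-((p - 1) / 2)) ≤ 1 / 2 :=
    hlim.eventually_le_const (by norm_num)
  refine limsup_le_of_le (IsBoundedUnder.isCoboundedUnder_le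
    ⟨-(alphaP p * ((N : ℝ) - 2 - alphaP p) * (1 / 2 - 1 / (p + 1))), ?_⟩) ?_
  · rw [eventually_map]
    filter_upwards [hsmall, eventually_gt_atTop 0] with c hc hc0
    set r := s * Real.exp L * c ^ (-((p - 1) / 2))
    have hr : 0 < r := by positivity
    have h1 : 0 ≤ 1 / 2 * r ^ 2 * (1 - r ^ 2) * (deriv (vFun N p u c) r) ^ 2 := by
      have : 0 ≤ 1 - r ^ 2 := by nlinarith
      positivity
    have h2 := mul_le_mul_of_nonneg_left (potential_le hp1 (vFun N p u c r)) hβ.le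
    rw [potential] at h2
    rw [Hv]
    linarith
  · filter_upwards [hsmall, eventually_gt_atTop 0, hinit] with c hc hc0 hinitc
    obtain ⟨hu1, hu2, hu3, hu4⟩ := hu c
    set t₀ := Real.log (s * c ^ (-((p - 1) / 2)))
    have ht₀ : Real.exp t₀ = s * c ^ (-((p - 1) / 2)) := Real.exp_log (by positivity)
    have htL : Real.exp (t₀ + L) = s * Real.exp L * c ^ (-((p - 1) / 2)) := by
      rw [Real.exp_add, ht₀]
      ring
    have hle : Real.exp (t₀ + L) ≤ 1 / 2 := htL ▸ hc
    have hlt : ∀ t ∈ Icc t₀ (t₀ + L), Real.exp t ≤ 1 / 2 := fun t ht =>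
      (Real.exp_le_exp.2 ht.2).trans hle
    have hstart := hinitc (u c) t₀ hu1 hu2 hu3 hu4 ht₀
      (hlt t₀ (left_mem_Icc.2 (by linarith)))
    have hend := hflow _ _ (logVDeriv2 (bInf N p) (alphaP p) (u c)) t₀ hle (fun t ht => by
      have h1 : Real.exp t < 1 := (hlt t ht).trans_lt (by norm_num)
      have h2 := hasDerivAt_logV (bInf N p) (alphaP p) hu1 h1
      exact ⟨h2.1, h2.2, logODE_of_isSolOn hp1 hβ hu2 h1⟩) hstart
    rw [← Hv_eq_logEnergy hu1 (hle.trans_lt (by norm_num)), htL, potential,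
      abs_of_pos (sub_pos.2 hε1)] at hend
    linarith
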